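/- Let Ψ be a monotonic expansion system that is proper at every order w.r.t. every element of S_0, and endow S_0 with the order topology of its linear order. Then Ψ is accurate (for every y ∈ S_0 the convergents y^{[n]} converge to y in the order topology) if and only if Ψ is separating. -/

import Mathlib

/-- An *expansion system* `Ψ`: element spaces `S i` with neutral elements `ν i`,
coefficient spaces `C i`, projections `P i : S i → C i` and expansions
`E i : S i → S (i+1)` such that `E i (ν i) = ν (i+1)` and each combined map
`F i = (P i, E i) : S i → C i × S (i+1)` is injective. -/
structure ExpansionSystem where
  S : ℕ → Type*
  C : ℕ → Type*
  ν : ∀ i, S i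
  P : ∀ i, S i → C i
  E : ∀ i, S i → S (i + 1)
  E_ν : ∀ i, E i (ν i) = ν (i + 1)
  F_inj : ∀ i, Function.Injective (fun y : S i => (P i y, E i y))

namespace ExpansionSystem

variable (Ψ : ExpansionSystem)

/-- `iter Ψ i y` is the element `y_i`: `y_0 = y`, `y_{i+1} = E i y_i`. -/
def iter : ∀ i : ℕ, Ψ.S 0 → Ψ.S i
  | 0, y => y
  | (i + 1), y => Ψ.E i (iter i y)

/-- The `i`-th coefficient `P̂_i y = P i (y_i)`. -/
def coeff (i : ℕ) (y : Ψ.S 0) : Ψ.C i := Ψ.P i (Ψ.iter i y)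

/-- The coefficient map `P̂ : S 0 → ∏ i, C i`. -/
def coeffMap (y : Ψ.S 0) : ∀ i, Ψ.C i := fun i => Ψ.coeff i y

/-- `a` records the backward recursion defining the `n`-th convergent of `y`:
`a n = ν n` and, for `i < n`, `F i (a i) = (P̂_i y, a (i+1))`, i.e.
`a i = F i ⁻¹ (P̂_i y, a (i+1))`; in particular at each step the pair
`(P̂_i y, a (i+1))` lies in the image of `F i`. -/
def IsChain (n : ℕ) (y : Ψ.S 0) (a : ∀ i, Ψ.S i) : Prop :=
  a n = Ψ.ν n ∧ ∀ i < n, Ψ.P i (a i) = Ψ.coeff i y ∧ Ψ.E i (a i) = a (i + 1)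

/-- `Ψ` is *proper at order `n` w.r.t. `y`*: the backward recursion
`y_n^[n] = ν n`, `y_i^[n] = F i ⁻¹ (P̂_i y, y_{i+1}^[n])` is well defined. -/
def ProperAt (n : ℕ) (y : Ψ.S 0) : Prop := ∃ a, Ψ.IsChain n y a

/-- `z` is the `n`-th convergent `y^[n]` of `y` (the outcome `y_0^[n]` of the
backward recursion). -/
def IsConvergent (n : ℕ) (y z : Ψ.S 0) : Prop := ∃ a, Ψ.IsChain n y a ∧ a 0 = z

end ExpansionSystem

namespace ExpansionSystem

variable (Ψ : ExpansionSystem) [∀ i, LinearOrder (Ψ.S i)] [∀ i, LinearOrder (Ψ.C i)]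

/-- `F i = (P i, E i)` is strictly increasing w.r.t. the dictionary order on
`C i × S (i+1)`: for `y < y'` one has `P i y ≤ P i y'`, and `E i y < E i y'`
whenever `P i y = P i y'`. -/
def FIncreasingAt (i : ℕ) : Prop :=
  ∀ y y' : Ψ.S i, y < y' →
    Ψ.P i y ≤ Ψ.P i y' ∧ (Ψ.P i y = Ψ.P i y' → Ψ.E i y < Ψ.E i y')

/-- `F i = (P i, E i)` is strictly decreasing w.r.t. the dictionary order on
`C i × S (i+1)`. -/
def FDecreasingAt (i : ℕ) : Prop :=
  ∀ y y' : Ψ.S i, y < y' →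
    Ψ.P i y' ≤ Ψ.P i y ∧ (Ψ.P i y = Ψ.P i y' → Ψ.E i y' < Ψ.E i y)

/-- `Ψ` is a strictly increasing expansion system. -/
def StrictlyIncreasingES : Prop := ∀ i, Ψ.FIncreasingAt i

/-- `Ψ` is a monotonic expansion system: each `F i` is strictly monotone
(strictly increasing or strictly decreasing) w.r.t. the dictionary order. -/
def MonotonicES : Prop := ∀ i, Ψ.FIncreasingAt i ∨ Ψ.FDecreasingAt i

/-- The dictionary (lexicographic) strict order on coefficient sequences: two
distinct sequences are compared at the first index where they differ. -/
def lexLt (a b : ∀ i, Ψ.C i) : Prop :=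
  ∃ k, (∀ i < k, a i = b i) ∧ a k < b k

end ExpansionSystem

namespace ExpansionSystem

theorem iter_eq_of_isChain {Ψ : ExpansionSystem} {n : ℕ} {y : Ψ.S 0} {a : ∀ i, Ψ.S i}
    (h : Ψ.IsChain n y a) : ∀ i ≤ n, Ψ.iter i (a 0) = a i
  | 0, _ => rfl
  | i + 1, hi => by
    rw [iter, iter_eq_of_isChain h i (by omega)]
    exact (h.2 i hi).2

theorem IsConvergent.coeff_eq {Ψ : ExpansionSystem} {n : ℕ} {y z : Ψ.S 0}
    (h : Ψ.IsConvergent n y z) {i : ℕ} (hi : i < n) : Ψ.coeff i z = Ψ.coeff i y := by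
  obtain ⟨a, ha, rfl⟩ := h
  rw [← (ha.2 i hi).1, coeff, iter_eq_of_isChain ha i hi.le]

theorem IsConvergent.of_coeffMap_eq {Ψ : ExpansionSystem} {n : ℕ} {y y' z : Ψ.S 0}
    (h : Ψ.IsConvergent n y z) (hy : Ψ.coeffMap y = Ψ.coeffMap y') : Ψ.IsConvergent n y' z := by
  obtain ⟨a, ha, hz⟩ := h
  refine ⟨a, ⟨ha.1, fun i hi => ⟨?_, (ha.2 i hi).2⟩⟩, hz⟩
  rw [(ha.2 i hi).1]
  exact congrFun hy i

/-- On elements sharing their first `k` coefficients, the `k`-fold expansion is strictly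
monotone or strictly antitone. -/
theorem MonotonicES.iter_lt {Ψ : ExpansionSystem} [∀ i, LinearOrder (Ψ.S i)]
    [∀ i, LinearOrder (Ψ.C i)] (hmono : Ψ.MonotonicES) (k : ℕ) :
    (∀ u v, (∀ i < k, Ψ.coeff i u = Ψ.coeff i v) → u < v → Ψ.iter k u < Ψ.iter k v) ∨
      (∀ u v, (∀ i < k, Ψ.coeff i u = Ψ.coeff i v) → u < v → Ψ.iter k v < Ψ.iter k u) := by
  induction k with
  | zero => exact Or.inl fun u v _ h => h
  | succ k ih =>
    rcases ih with ih | ih <;> rcases hmono k with hk | hk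
    · exact Or.inl fun u v h huv =>
        (hk _ _ (ih u v (fun i hi => h i (by omega)) huv)).2 (h k (by omega))
    · exact Or.inr fun u v h huv =>
        (hk _ _ (ih u v (fun i hi => h i (by omega)) huv)).2 (h k (by omega))
    · exact Or.inr fun u v h huv =>
        (hk _ _ (ih u v (fun i hi => h i (by omega)) huv)).2 (h k (by omega)).symm
    · exact Or.inl fun u v h huv =>
        (hk _ _ (ih u v (fun i hi => h i (by omega)) huv)).2 (h k (by omega)).symm

/-- On elements sharing their first `k` coefficients, the `k`-th coefficient is monotone or
antitone. -/
theorem MonotonicES.coeff_le {Ψ : ExpansionSystem} [∀ i, LinearOrder (Ψ.S i)]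
    [∀ i, LinearOrder (Ψ.C i)] (hmono : Ψ.MonotonicES) (k : ℕ) :
    (∀ u v, (∀ i < k, Ψ.coeff i u = Ψ.coeff i v) → u < v → Ψ.coeff k u ≤ Ψ.coeff k v) ∨
      (∀ u v, (∀ i < k, Ψ.coeff i u = Ψ.coeff i v) → u < v → Ψ.coeff k v ≤ Ψ.coeff k u) := by
  rcases hmono.iter_lt k with h | h <;> rcases hmono k with hk | hk
  · exact Or.inl fun u v e huv => (hk _ _ (h u v e huv)).1
  · exact Or.inr fun u v e huv => (hk _ _ (h u v e huv)).1
  · exact Or.inr fun u v e huv => (hk _ _ (h u v e huv)).1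
  · exact Or.inl fun u v e huv => (hk _ _ (h u v e huv)).1

/-- The order between two elements is decided by their coefficients up to the first index at
which these differ. -/
theorem MonotonicES.exists_forall_lt_of_coeff_eq {Ψ : ExpansionSystem} [∀ i, LinearOrder (Ψ.S i)]
    [∀ i, LinearOrder (Ψ.C i)] (hmono : Ψ.MonotonicES) {a y : Ψ.S 0}
    (hne : Ψ.coeffMap a ≠ Ψ.coeffMap y) :
    ∃ k, ∀ z, (∀ i ≤ k, Ψ.coeff i z = Ψ.coeff i y) → (a < y → a < z) ∧ (y < a → z < a) := by
  classical
  have hex : ∃ k, Ψ.coeff k a ≠ Ψ.coeff k y := Function.ne_iff.mp hne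
  obtain ⟨k, hk, hmin⟩ : ∃ k, Ψ.coeff k a ≠ Ψ.coeff k y ∧ ∀ i < k, Ψ.coeff i a = Ψ.coeff i y :=
    ⟨Nat.find hex, Nat.find_spec hex, fun i hi => not_not.mp (Nat.find_min hex hi)⟩
  refine ⟨k, fun z hz => ?_⟩
  have hza : ∀ i < k, Ψ.coeff i z = Ψ.coeff i a := fun i hi => (hz i hi.le).trans (hmin i hi).symm
  have hzk := hz k le_rfl
  have hzne : z ≠ a := fun h => hk (h ▸ hzk)
  rcases hmono.coeff_le k with h | h
  · refine ⟨fun hay => ?_, fun hay => ?_⟩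
    · by_contra hlt
      have h₁ := h a y hmin hay
      have h₂ := h z a hza (lt_of_le_of_ne (not_lt.mp hlt) hzne)
      exact hk (le_antisymm h₁ (hzk ▸ h₂))
    · by_contra hlt
      have h₁ := h y a (fun i hi => (hmin i hi).symm) hay
      have h₂ := h a z (fun i hi => (hza i hi).symm) (lt_of_le_of_ne (not_lt.mp hlt) hzne.symm)
      exact hk (le_antisymm (hzk ▸ h₂) h₁)
  · refine ⟨fun hay => ?_, fun hay => ?_⟩
    · by_contra hlt
      have h₁ := h a y hmin hay
      have h₂ := h z a hza (lt_of_le_of_ne (not_lt.mp hlt) hzne)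
      exact hk (le_antisymm (hzk ▸ h₂) h₁)
    · by_contra hlt
      have h₁ := h y a (fun i hi => (hmin i hi).symm) hay
      have h₂ := h a z (fun i hi => (hza i hi).symm) (lt_of_le_of_ne (not_lt.mp hlt) hzne.symm)
      exact hk (le_antisymm h₁ (hzk ▸ h₂))

end ExpansionSystem

/-- let `Ψ` be a monotonic expansion system, proper at every order
w.r.t. every element, with `S 0` carrying the order topology of its linear order.
Then `Ψ` is accurate (every sequence of convergents `y^[n]` converges to `y` in
the order topology) iff `Ψ` is separating. -/
theorem stmt13 (Ψ : ExpansionSystem) [∀ i, LinearOrder (Ψ.S i)] [∀ i, LinearOrder (Ψ.C i)]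
    (hmono : Ψ.MonotonicES)
    (hproper : ∀ (y : Ψ.S 0) (n : ℕ), Ψ.ProperAt n y) :
    (∀ (y : Ψ.S 0) (c : ℕ → Ψ.S 0), (∀ n, Ψ.IsConvergent n y (c n)) →
        Filter.Tendsto c Filter.atTop (@nhds _ (Preorder.topology (Ψ.S 0)) y)) ↔
      Function.Injective Ψ.coeffMap := by
  let _ : TopologicalSpace (Ψ.S 0) := Preorder.topology (Ψ.S 0)
  have : OrderTopology (Ψ.S 0) := ⟨rfl⟩
  constructor
  · intro hacc y y' hyy'
    have hconv : ∀ n, ∃ z, Ψ.IsConvergent n y z := fun n =>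
      let ⟨a, ha⟩ := hproper y n
      ⟨a 0, a, ha, rfl⟩
    choose c hc using hconv
    exact tendsto_nhds_unique (hacc y c hc) (hacc y' c fun n => (hc n).of_coeffMap_eq hyy')
  · intro hinj y c hc
    have hev : ∀ a, a ≠ y → ∀ᶠ n in Filter.atTop, (a < y → a < c n) ∧ (y < a → c n < a) := by
      intro a ha
      obtain ⟨k, hk⟩ := hmono.exists_forall_lt_of_coeff_eq (hinj.ne ha)
      filter_upwards [Filter.eventually_gt_atTop k] with n hn
      exact hk (c n) fun i hi => (hc n).coeff_eq (lt_of_le_of_lt hi hn)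
    refine tendsto_order.mpr ⟨fun a ha => ?_, fun a ha => ?_⟩
    · exact (hev a ha.ne).mono fun n h => h.1 ha
    · exact (hev a ha.ne').mono fun n h => h.2 ha
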